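/- Fix s ∈ [0,1/2]. The integral ∫_Γ exp[(s−1) Σ_{u∈γ} φ(u)] μ(dγ) is well defined, finite, and strictly positive (where exp[(s−1)·(+∞)] is interpreted as 0), so that its reciprocal in the normalization condition ∫ a(x) dx = (∫_Γ exp[(s−1) Σ_{u∈γ} φ(u)] μ(dγ))^{−1} makes sense. -/

import Mathlib

open MeasureTheory Set Filter
open scoped ENNReal NNReal BigOperators Topology Classical

noncomputable section

abbrev EucSp (d : ℕ) := EuclideanSpace ℝ (Fin d)

/-- The configuration space `Γ` over `ℝ^d`: locally finite subsets. -/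
def Config (d : ℕ) : Type :=
  {γ : Set (EucSp d) // ∀ Λ : Set (EucSp d), IsCompact Λ → (γ ∩ Λ).Finite}

/-- The σ-algebra on `Γ` generated by the maps `γ ↦ |γ ∩ B|`, `B` Borel. -/
instance Config.instMS (d : ℕ) : MeasurableSpace (Config d) :=
  ⨆ (B : Set (EucSp d)) (_ : MeasurableSet B),
    MeasurableSpace.comap (fun γ : Config d => (γ.1 ∩ B).encard) (⊤ : MeasurableSpace ℕ∞)

/-- `γ ∪ {x}`. -/
def Config.ins {d : ℕ} (γ : Config d) (x : EucSp d) : Config d :=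
  ⟨insert x γ.1, fun Λ hΛ => ((γ.2 Λ hΛ).insert x).subset fun y hy => by
    rcases hy with ⟨h1, h2⟩
    rcases h1 with rfl | h1
    · exact Set.mem_insert _ _
    · exact Set.mem_insert_of_mem _ ⟨h1, h2⟩⟩

/-- `γ ∖ {x}`. -/
def Config.del {d : ℕ} (γ : Config d) (x : EucSp d) : Config d :=
  ⟨γ.1 \ {x}, fun Λ hΛ => (γ.2 Λ hΛ).subset fun y hy => ⟨hy.1.1, hy.2⟩⟩

/-- The pairing `⟨f, γ⟩ = ∑_{x ∈ γ} f x`. -/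
def cpair {d : ℕ} (f : EucSp d → ℝ) (γ : Config d) : ℝ := ∑' x : γ.1, f x.1

/-- `exp : [-∞,∞] → [0,∞]`. -/
def eexp (x : EReal) : ℝ≥0∞ :=
  if x = ⊤ then ⊤ else if x = ⊥ then 0 else ENNReal.ofReal (Real.exp x.toReal)

/-- real-valued exponential of an extended real (with `exp(±∞)` sent to junk value `0`). -/
def rexp (x : EReal) : ℝ := (eexp x).toReal

/-- The relative energy `E(x,γ) = ∑_{y ∈ γ} φ(x-y)` if absolutely convergent, `+∞` otherwise. -/
def energy {d : ℕ} (φ : EucSp d → EReal) (x : EucSp d) (γ : Set (EucSp d)) : EReal :=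
  if (∀ y ∈ γ, φ (x - y) ≠ ⊤) ∧ Summable (fun y : γ => (φ (x - y.1)).toReal)
  then (((∑' y : γ, (φ (x - y.1)).toReal) : ℝ) : EReal)
  else ⊤

/-- `∑_{u ∈ γ} φ(u)` if absolutely convergent, `+∞` otherwise. -/
def totPhi {d : ℕ} (φ : EucSp d → EReal) (γ : Set (EucSp d)) : EReal :=
  if (∀ y ∈ γ, φ y ≠ ⊤) ∧ Summable (fun y : γ => (φ y.1).toReal)
  then (((∑' y : γ, (φ y.1).toReal) : ℝ) : EReal)
  else ⊤

/-- A pair potential: Borel, even, with `φ(x) ∈ ℝ` off the origin. -/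
structure IsPairPotential {d : ℕ} (φ : EucSp d → EReal) : Prop where
  meas : Measurable φ
  even : ∀ x : EucSp d, x ≠ 0 → φ (-x) = φ x
  finite_off : ∀ x : EucSp d, x ≠ 0 → φ x ≠ ⊤
  ne_bot : ∀ x, φ x ≠ ⊥

/-- Stability (S): `∑_{{x,y} ⊆ η} φ(x-y) ≥ -B|η|` for all finite `η`
(stated with the sum over ordered pairs, which doubles both sides). -/
def Stable {d : ℕ} (φ : EucSp d → EReal) (B : ℝ) : Prop :=
  ∀ η : Finset (EucSp d),
    ((-(2 * B * η.card) : ℝ) : EReal) ≤ ∑ p ∈ η.offDiag, φ (p.1 - p.2)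

/-- Low activity–high temperature (LA-HT): `∫ |e^{-φ} - 1| z dx < (2 e^{1+2B})⁻¹`. -/
def LAHT {d : ℕ} (φ : EucSp d → EReal) (z B : ℝ) : Prop :=
  ∫⁻ x : EucSp d, ENNReal.ofReal (|rexp (-(φ x)) - 1| * z)
    < ENNReal.ofReal (2 * Real.exp (1 + 2 * B))⁻¹

/-- The Georgii–Nguyen–Zessin identity characterizing `μ ∈ G(z,φ)`. -/
def GNZ {d : ℕ} (z : ℝ) (φ : EucSp d → EReal) (μ : Measure (Config d)) : Prop :=
  ∀ F : Config d → EucSp d → ℝ≥0∞,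
    Measurable (Function.uncurry F) →
    ∫⁻ γ, ∑' x : γ.1, F γ x.1 ∂μ
      = ∫⁻ γ, ∫⁻ x, ENNReal.ofReal z * eexp (-(energy φ x γ.1)) * F (γ.ins x) x ∂volume ∂μ


/-- Ordered `n`-tuples of distinct points of `γ`. -/
def injTuples {d : ℕ} (n : ℕ) (γ : Set (EucSp d)) : Set (Fin n → EucSp d) :=
  {p | Function.Injective p ∧ ∀ i, p i ∈ γ}

/-- `(k_μ^{(n)})` is the family of correlation functions of `μ`: each `k n` is measurable,
nonnegative and symmetric, and for every measurable symmetric `f : (ℝ^d)^n → [0,∞]`,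
`∫_Γ ∑_{{x_1,…,x_n} ⊆ γ} f dμ = (1/n!) ∫ f·kₙ dx` (stated equivalently via the sum over
ordered tuples of distinct points, which absorbs the factor `1/n!`). -/
def HasCorrFns {d : ℕ} (μ : Measure (Config d)) (k : ∀ n : ℕ, (Fin n → EucSp d) → ℝ) : Prop :=
  (∀ n : ℕ, Measurable (k n) ∧ (∀ x, 0 ≤ k n x) ∧
      ∀ (σ : Equiv.Perm (Fin n)) (x : Fin n → EucSp d), k n (x ∘ σ) = k n x) ∧
  ∀ n : ℕ, 0 < n → ∀ f : (Fin n → EucSp d) → ℝ≥0∞, Measurable f →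
    (∀ (σ : Equiv.Perm (Fin n)) (x : Fin n → EucSp d), f (x ∘ σ) = f x) →
    ∫⁻ γ, ∑' p : injTuples n γ.1, f p.1 ∂μ
      = ∫⁻ x : Fin n → EucSp d, f x * ENNReal.ofReal (k n x)

/-- The Ruelle bound `k^{(n)} ≤ ξⁿ`. -/
def RuelleBound {d : ℕ} (k : ∀ n : ℕ, (Fin n → EucSp d) → ℝ) (ξ : ℝ) : Prop :=
  ∀ n : ℕ, 0 < n → ∀ x : Fin n → EucSp d, k n x ≤ ξ ^ n

/-- Translation invariance of a family of functions on tuples. -/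
def TransInvFns {d : ℕ} (k : ∀ n : ℕ, (Fin n → EucSp d) → ℝ) : Prop :=
  ∀ (n : ℕ) (a : EucSp d) (x : Fin n → EucSp d), k n (fun i => x i + a) = k n x

/-- `P` is a partition of `{0,…,n-1}` into nonempty pairwise disjoint blocks. -/
def IsPartOfUniv {n : ℕ} (P : Finset (Finset (Fin n))) : Prop :=
  (∀ b ∈ P, b.Nonempty) ∧ (P : Set (Finset (Fin n))).PairwiseDisjoint id ∧
    P.sup id = Finset.univ

/-- `u` is the family of Ursell functions of `k`:
`k(η) = ∑ u(η_1) ⋯ u(η_j)`, summing over all partitions of `η`. -/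
def IsUrsell {d : ℕ} (k u : ∀ n : ℕ, (Fin n → EucSp d) → ℝ) : Prop :=
  ∀ n : ℕ, 0 < n → ∀ x : Fin n → EucSp d,
    k n x = ∑ P : Finset (Finset (Fin n)),
      if IsPartOfUniv P then ∏ b ∈ P, u b.card (fun i => x (b.orderIsoOfFin rfl i).1) else 0

/-- `f ∈ C_0(ℝ^d)`: continuous with compact support. -/
def IsC0 {d : ℕ} (f : EucSp d → ℝ) : Prop := Continuous f ∧ HasCompactSupport f

/-- Cylinder functions `FC_b(C_0(ℝ^d),Γ)`. -/
def Cyl {d : ℕ} (F : Config d → ℝ) : Prop :=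
  ∃ (N : ℕ) (f : Fin N → EucSp d → ℝ) (g : (Fin N → ℝ) → ℝ),
    (∀ i, IsC0 (f i)) ∧ Continuous g ∧ (∃ C, ∀ y, |g y| ≤ C) ∧
    ∀ γ, F γ = g fun i => cpair (f i) γ

/-- `(D_x^- F)(γ) = F(γ∖x) - F(γ)`. -/
def Dminus {d : ℕ} (F : Config d → ℝ) (x : EucSp d) (γ : Config d) : ℝ := F (γ.del x) - F γ

/-- `(D_x^+ F)(γ) = F(γ∪x) - F(γ)`. -/
def Dplus {d : ℕ} (F : Config d → ℝ) (x : EucSp d) (γ : Config d) : ℝ := F (γ.ins x) - F γ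

/-- `(D_{xy}^{-+} F)(γ) = F(γ∖x∪y) - F(γ)`. -/
def Dpm {d : ℕ} (F : Config d → ℝ) (x y : EucSp d) (γ : Config d) : ℝ :=
  F ((γ.del x).ins y) - F γ

/-- The Glauber bilinear form `E_G`. -/
def glauberForm {d : ℕ} (s : ℝ) (φ : EucSp d → EReal) (μ : Measure (Config d))
    (F G : Config d → ℝ) : ℝ :=
  ∫ γ, (∑' x : γ.1,
      rexp ((s : EReal) * energy φ x.1 (γ.1 \ {x.1})) * Dminus F x.1 γ * Dminus G x.1 γ) ∂μ

/-- The Kawasaki bilinear form `E_K`. -/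
def kawasakiForm {d : ℕ} (s : ℝ) (a : EucSp d → ℝ) (φ : EucSp d → EReal)
    (μ : Measure (Config d)) (F G : Config d → ℝ) : ℝ :=
  (1 / 2) * ∫ γ, (∑' x : γ.1, ∫ y : EucSp d,
      a (x.1 - y) *
        rexp ((s : EReal) * energy φ x.1 (γ.1 \ {x.1}) +
          ((s - 1 : ℝ) : EReal) * energy φ y (γ.1 \ {x.1})) *
        Dpm F x.1 y γ * Dpm G x.1 y γ) ∂μ

/-- The Glauber generator `H_G`. -/
def HG {d : ℕ} (s z : ℝ) (φ : EucSp d → EReal) (F : Config d → ℝ) (γ : Config d) : ℝ :=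
  -(∑' x : γ.1, rexp ((s : EReal) * energy φ x.1 (γ.1 \ {x.1})) * Dminus F x.1 γ)
    - ∫ x : EucSp d, z * rexp (((s - 1 : ℝ) : EReal) * energy φ x γ.1) * Dplus F x γ

/-- The Kawasaki generator `H_K`. -/
def HK {d : ℕ} (s : ℝ) (a : EucSp d → ℝ) (φ : EucSp d → EReal) (F : Config d → ℝ)
    (γ : Config d) : ℝ :=
  -(∑' x : γ.1, ∫ y : EucSp d,
      a (x.1 - y) * rexp ((s : EReal) * energy φ x.1 (γ.1 \ {x.1}) +
        ((s - 1 : ℝ) : EReal) * energy φ y (γ.1 \ {x.1})) * Dpm F x.1 y γ)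

/-- The scaled jump kernel `a_ε(x) = ε^d a(ε x)`. -/
def aScaled {d : ℕ} (a : EucSp d → ℝ) (ε : ℝ) (x : EucSp d) : ℝ := ε ^ d * a (ε • x)

/-- `H_ε^-` (death part of the Kawasaki generator with kernel `aa`). -/
def HepsMinus {d : ℕ} (s : ℝ) (aa : EucSp d → ℝ) (φ : EucSp d → EReal)
    (F : Config d → ℝ) (γ : Config d) : ℝ :=
  -(∑' x : γ.1, Dminus F x.1 γ * ∫ y : EucSp d,
      aa (x.1 - y) * rexp ((s : EReal) * energy φ x.1 (γ.1 \ {x.1}) +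
        ((s - 1 : ℝ) : EReal) * energy φ y (γ.1 \ {x.1})))

/-- `H_ε^+` (birth part of the Kawasaki generator with kernel `aa`). -/
def HepsPlus {d : ℕ} (s : ℝ) (aa : EucSp d → ℝ) (φ : EucSp d → EReal)
    (F : Config d → ℝ) (γ : Config d) : ℝ :=
  -(∑' x : γ.1, ∫ y : EucSp d,
      aa (x.1 - y) * rexp ((s : EReal) * energy φ x.1 (γ.1 \ {x.1}) +
        ((s - 1 : ℝ) : EReal) * energy φ y (γ.1 \ {x.1})) * Dplus F y (γ.del x.1))

/-- `H_0^-` (death part of the Glauber generator). -/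
def H0Minus {d : ℕ} (s : ℝ) (φ : EucSp d → EReal) (F : Config d → ℝ) (γ : Config d) : ℝ :=
  -(∑' x : γ.1, rexp ((s : EReal) * energy φ x.1 (γ.1 \ {x.1})) * Dminus F x.1 γ)

/-- `H_0^+` (birth part of the Glauber generator). -/
def H0Plus {d : ℕ} (s z : ℝ) (φ : EucSp d → EReal) (F : Config d → ℝ) (γ : Config d) : ℝ :=
  -∫ x : EucSp d, z * rexp (((s - 1 : ℝ) : EReal) * energy φ x γ.1) * Dplus F x γ

/-- The standing assumptions of the paper: `s ∈ [0,1/2]`, a stable pair potential in the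
low activity–high temperature regime, bounded outside a ball, and `μ` the Gibbs measure
from Ruelle's theorem with its correlation and Ursell functions. -/
structure Setting (d : ℕ) (s z B ξ : ℝ) (φ : EucSp d → EReal) (μ : Measure (Config d))
    (k u : ∀ n : ℕ, (Fin n → EucSp d) → ℝ) : Prop where
  hd : 0 < d
  hs0 : 0 ≤ s
  hs1 : s ≤ 1 / 2
  pp : IsPairPotential φ
  hB : 0 ≤ B
  stable : Stable φ B
  hz : 0 < z
  laht : LAHT φ z B
  bddOutside : ∃ R C : ℝ, ∀ x : EucSp d, R ≤ ‖x‖ → ∃ r : ℝ, φ x = (r : EReal) ∧ |r| ≤ C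
  prob : IsProbabilityMeasure μ
  gnz : GNZ z φ μ
  corr : HasCorrFns μ k
  ti : TransInvFns k
  hξ : 0 < ξ
  ruelle : RuelleBound k ξ
  ursell : IsUrsell k u
  ursellInt : ∀ m : ℕ,
    Integrable (fun y : Fin (m + 1) → EucSp d => u (m + 2) (Fin.cons 0 y)) volume

/-- The jump kernel `a`: bounded, nonnegative, even, integrable. -/
structure GoodA {d : ℕ} (a : EucSp d → ℝ) : Prop where
  meas : Measurable a
  nonneg : ∀ x, 0 ≤ a x
  bdd : ∃ C, ∀ x, a x ≤ C
  even : ∀ x, a (-x) = a x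
  int : Integrable a volume

/-- `φ(x) → 0` as `|x| → ∞`. -/
def PhiVanishes {d : ℕ} (φ : EucSp d → EReal) : Prop :=
  Tendsto φ (cocompact (EucSp d)) (nhds (0 : EReal))

/-- The normalization `∫ a dx = (∫_Γ exp[(s-1) ∑_{u∈γ} φ(u)] dμ(γ))⁻¹`. -/
def NormalizedA {d : ℕ} (s : ℝ) (a : EucSp d → ℝ) (φ : EucSp d → EReal)
    (μ : Measure (Config d)) : Prop :=
  (∫ x : EucSp d, a x) = (∫ γ, rexp (((s - 1 : ℝ) : EReal) * totPhi φ γ.1) ∂μ)⁻¹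


section KernelSFinite

open ProbabilityTheory

/-- A kernel which is finite, pointwise in the first argument, on each cell of a countable
measurable partition is s-finite. -/
lemma isSFiniteKernel_of_partition {α β : Type*} [MeasurableSpace α] [MeasurableSpace β]
    (κ : Kernel α β) {A : ℕ → Set β} (hA : ∀ m, MeasurableSet (A m))
    (hd : Pairwise (Function.onFun Disjoint A)) (hU : ⋃ m, A m = Set.univ)
    (hfin : ∀ a m, κ a (A m) ≠ ⊤) : IsSFiniteKernel κ := by
  have hS : ∀ m N : ℕ, MeasurableSet {a | ⌊(κ a (A m)).toNNReal⌋₊ = N} := fun m N =>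
    (Nat.measurable_floor.comp (κ.measurable_coe (hA m)).ennreal_toNNReal)
      (measurableSet_singleton N)
  have hpw : ∀ m N : ℕ, IsFiniteKernel
      (Kernel.piecewise (hS m N) (κ.restrict (hA m)) (0 : Kernel α β)) := by
    intro m N
    refine ⟨⟨((N + 1 : ℕ) : ℝ≥0∞), ENNReal.natCast_lt_top _, fun a => ?_⟩⟩
    rw [Kernel.piecewise_apply']
    split_ifs with h
    · rw [Kernel.restrict_apply, Measure.restrict_apply MeasurableSet.univ, Set.univ_inter,
        ← ENNReal.coe_toNNReal (hfin a m)]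
      have h1 := (Nat.lt_floor_add_one (κ a (A m)).toNNReal).le
      rw [Set.mem_ofPred_eq] at h
      rw [h] at h1
      exact_mod_cast h1
    · simp
  have hsum : κ = Kernel.sum fun m => Kernel.sum fun N =>
      Kernel.piecewise (hS m N) (κ.restrict (hA m)) (0 : Kernel α β) := by
    ext a t ht
    rw [Kernel.sum_apply' _ _ ht]
    simp_rw [Kernel.sum_apply' _ _ ht, Kernel.piecewise_apply', Set.mem_ofPred_eq,
      Kernel.restrict_apply, Measure.restrict_apply ht]
    have : ∀ m, ∑' N : ℕ, (if ⌊(κ a (A m)).toNNReal⌋₊ = N then κ a (t ∩ A m)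
        else (0 : Kernel α β) a t) = κ a (t ∩ A m) := by
      intro m
      simp
    simp_rw [this]
    rw [← measure_iUnion (fun i j hij => (hd hij).mono inter_subset_right inter_subset_right)
      (fun i => ht.inter (hA i)), ← Set.inter_iUnion, hU, Set.inter_univ]
  rw [hsum]
  infer_instance

end KernelSFinite

namespace Config

open ProbabilityTheory

variable {d : ℕ}

lemma countable_coe (γ : Config d) : γ.1.Countable := by
  have h : γ.1 = ⋃ n : ℕ, γ.1 ∩ Metric.closedBall 0 n := by
    rw [← Set.inter_iUnion, Metric.iUnion_closedBall_nat, Set.inter_univ]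
  rw [h]
  exact Set.countable_iUnion fun n => (γ.2 _ (isCompact_closedBall _ _)).countable

/-- The kernel sending a configuration to the sum of Dirac masses at its points. -/
def kernel (d : ℕ) : Kernel (Config d) (EucSp d) where
  toFun γ := Measure.count.restrict γ.1
  measurable' := by
    refine Measure.measurable_of_measurable_coe _ fun B hB => ?_
    have h : ∀ γ : Config d, (Measure.count.restrict γ.1) B =
        (((γ.1 ∩ B).encard : ℕ∞) : ℝ≥0∞) := fun γ => by
      rw [Measure.restrict_apply hB, Measure.count_apply (hB.inter γ.countable_coe.measurableSet),
        Set.inter_comm]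
    simp_rw [h]
    have h2 : @Measurable _ _ (Config.instMS d) ⊤ (fun γ : Config d => (γ.1 ∩ B).encard) :=
      measurable_iff_comap_le.2 (le_iSup₂_of_le B hB le_rfl)
    intro s _
    exact h2 (t := (fun n : ℕ∞ => (n : ℝ≥0∞)) ⁻¹' s) trivial

lemma kernel_apply (γ : Config d) : kernel d γ = Measure.count.restrict γ.1 := rfl

lemma lintegral_kernel (γ : Config d) (f : EucSp d → ℝ≥0∞) :
    ∫⁻ x, f x ∂(kernel d γ) = ∑' x : γ.1, f x.1 := by
  rw [kernel_apply, lintegral_countable _ γ.countable_coe]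
  simp

instance : IsSFiniteKernel (kernel d) := by
  have hm : Measurable fun x : EucSp d => ⌊‖x‖⌋₊ := Nat.measurable_floor.comp measurable_norm
  refine isSFiniteKernel_of_partition (kernel d)
    (A := fun m => (fun x : EucSp d => ⌊‖x‖⌋₊) ⁻¹' {m})
    (fun m => hm (measurableSet_singleton m)) ?_ ?_ ?_
  · intro i j hij
    exact Disjoint.preimage _ (by simpa using hij)
  · ext x
    simp
  · intro γ m
    rw [kernel_apply, Measure.restrict_apply (hm (measurableSet_singleton m))]
    refine (Measure.count_apply_lt_top.2 ?_).ne
    refine (γ.2 _ (isCompact_closedBall 0 (m + 1 : ℝ))).subset ?_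
    rintro x ⟨hx, hxγ⟩
    refine ⟨hxγ, ?_⟩
    have hx' : ⌊‖x‖⌋₊ = m := hx
    simpa [hx'] using (Nat.lt_floor_add_one ‖x‖).le

lemma measurable_tsum {Ω : Type*} [MeasurableSpace Ω] {c : Ω → Config d} (hc : Measurable c)
    {G : Ω × EucSp d → ℝ≥0∞} (hG : Measurable G) :
    Measurable fun ω => ∑' x : (c ω).1, G (ω, x.1) := by
  have h := Measurable.lintegral_kernel_prod_right' (κ := (kernel d).comap c hc) hG
  simpa only [Kernel.comap_apply, lintegral_kernel] using h

lemma measurable_tsum_coe {g : EucSp d → ℝ≥0∞} (hg : Measurable g) :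
    Measurable fun γ : Config d => ∑' x : γ.1, g x.1 :=
  measurable_tsum (c := id) measurable_id (G := fun w => g w.2) (hg.comp measurable_snd)

lemma measurable_tsum_tuples (n : ℕ) : ∀ {Ω : Type} [MeasurableSpace Ω] {c : Ω → Config d}
    (_ : Measurable c) {G : Ω × (Fin n → EucSp d) → ℝ≥0∞} (_ : Measurable G),
    Measurable fun ω => ∑' p : Fin n → (c ω).1, G (ω, fun i => (p i).1) := by
  induction n with
  | zero =>
    intro Ω _ c _ G hG
    have h : ∀ ω, ∑' p : Fin 0 → (c ω).1, G (ω, fun i => (p i).1) = G (ω, Fin.elim0) := by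
      intro ω
      rw [tsum_fintype, Fintype.sum_unique]
      congr 2
      exact Subsingleton.elim _ _
    simp_rw [h]
    fun_prop
  | succ n ih =>
    intro Ω _ c hc G hG
    have h : ∀ ω, ∑' p : Fin (n + 1) → (c ω).1, G (ω, fun i => (p i).1) =
        ∑' x : (c ω).1, ∑' q : Fin n → (c ω).1, G (ω, Fin.cons x.1 fun i => (q i).1) := by
      intro ω
      rw [← (Fin.consEquiv fun _ => (c ω).1).tsum_eq, ENNReal.tsum_prod']
      refine tsum_congr fun x => tsum_congr fun q => ?_
      congr 2
      ext1 i
      refine Fin.cases ?_ (fun j => ?_) i <;> simp [Fin.consEquiv]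
    simp_rw [h]
    refine measurable_tsum hc
      (G := fun w => ∑' q : Fin n → (c w.1).1, G (w.1, Fin.cons w.2 fun i => (q i).1)) ?_
    refine ih (c := fun w : Ω × EucSp d => c w.1) (hc.comp measurable_fst)
      (G := fun w => G (w.1.1, Fin.cons w.1.2 w.2)) (hG.comp ?_)
    refine (measurable_fst.comp measurable_fst).prodMk (measurable_pi_lambda _ fun i => ?_)
    refine Fin.cases ?_ (fun j => ?_) i
    · simp only [Fin.cons_zero]
      fun_prop
    · simp only [Fin.cons_succ]
      fun_prop

lemma measurableSet_injective (n : ℕ) :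
    MeasurableSet {p : Fin n → EucSp d | Function.Injective p} := by
  have h : {p : Fin n → EucSp d | Function.Injective p} =
      ⋂ (i : Fin n) (j : Fin n) (_ : i ≠ j), {p | p i ≠ p j} := by
    ext p
    simp only [Set.mem_ofPred_eq, Set.mem_iInter, Function.Injective]
    exact ⟨fun h i j hij e => hij (h e), fun h i j e => by_contra fun hij => h i j hij e⟩
  rw [h]
  refine MeasurableSet.iInter fun i => MeasurableSet.iInter fun j => MeasurableSet.iInter fun _ => ?_
  exact (measurableSet_eq_fun (measurable_pi_apply i) (measurable_pi_apply j)).compl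

lemma measurable_tsum_injTuples (n : ℕ) {f : (Fin n → EucSp d) → ℝ≥0∞} (hf : Measurable f) :
    Measurable fun γ : Config d => ∑' p : injTuples n γ.1, f p.1 := by
  have h : ∀ γ : Config d, ∑' p : injTuples n γ.1, f p.1 = ∑' p : Fin n → γ.1,
      ({p : Fin n → EucSp d | Function.Injective p}.indicator f) fun i => (p i).1 := by
    intro γ
    have e : ∑' p : Fin n → γ.1,
        ({p : Fin n → EucSp d | Function.Injective p}.indicator f) (fun i => (p i).1) =
        ∑' q : {q : Fin n → EucSp d | ∀ i, q i ∈ γ.1},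
        ({p : Fin n → EucSp d | Function.Injective p}.indicator f) q.1 := by
      rw [← Equiv.tsum_eq (Equiv.subtypePiEquivPi (p := fun (_ : Fin n) x => x ∈ γ.1))]
      rfl
    rw [e, tsum_subtype, tsum_subtype, Set.indicator_indicator]
    have hs : injTuples n γ.1 =
        {q : Fin n → EucSp d | ∀ i, q i ∈ γ.1} ∩ {p | Function.Injective p} := by
      ext p
      simp [injTuples, and_comm]
    rw [hs]
  simp_rw [h]
  exact measurable_tsum_tuples n (c := id) measurable_id
    (G := fun w => ({p : Fin n → EucSp d | Function.Injective p}.indicator f) w.2)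
    ((hf.indicator (measurableSet_injective n)).comp measurable_snd)

end Config

lemma lintegral_pi_prod {d : ℕ} {g : EucSp d → ℝ≥0∞} (hg : Measurable g) (n : ℕ) :
    ∫⁻ x : Fin n → EucSp d, ∏ i, g (x i) = (∫⁻ x, g x) ^ n := by
  have hm : ∀ n, Measurable fun x : Fin n → EucSp d => ∏ i, g (x i) := fun n =>
    Finset.measurable_fun_prod _ fun i _ => hg.comp (measurable_pi_apply i)
  induction n with
  | zero => simp [lintegral_unique, volume_pi]
  | succ n ih =>
    rw [← (volume_preserving_piFinSuccAbove (fun _ : Fin (n + 1) => EucSp d) 0).symm.lintegral_comp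
      (hm (n + 1))]
    simp only [Fin.prod_univ_succ, MeasurableEquiv.piFinSuccAbove_symm_apply, Fin.insertNthEquiv_apply,
      Fin.insertNth_zero', Fin.cons_zero, Fin.cons_succ]
    rw [Measure.volume_eq_prod, lintegral_prod_mul hg.aemeasurable (hm n).aemeasurable, ih, pow_succ']

section Correlations

variable {d : ℕ} {μ : Measure (Config d)} {k : ∀ n : ℕ, (Fin n → EucSp d) → ℝ} {ξ : ℝ}

lemma lintegral_tsum_injTuples_le [IsProbabilityMeasure μ] (hk : HasCorrFns μ k) (hξ : 0 ≤ ξ)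
    (hR : RuelleBound k ξ) {g : EucSp d → ℝ≥0∞} (hg : Measurable g) (n : ℕ) :
    ∫⁻ γ, ∑' p : injTuples n γ.1, ∏ i, g (p.1 i) ∂μ ≤ (ENNReal.ofReal ξ * ∫⁻ x, g x) ^ n := by
  rcases Nat.eq_zero_or_pos n with rfl | hn
  · have h : ∀ γ : Config d, ∑' p : injTuples 0 γ.1, ∏ i, g (p.1 i) ≤ 1 := by
      intro γ
      simp only [Finset.univ_eq_empty, Finset.prod_empty]
      rw [tsum_fintype, Finset.sum_const, nsmul_one]
      exact_mod_cast Finset.card_le_one_of_subsingleton _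
    calc _ ≤ ∫⁻ _ : Config d, 1 ∂μ := lintegral_mono h
      _ = _ := by simp
  · have hm : Measurable fun x : Fin n → EucSp d => ∏ i, g (x i) :=
      Finset.measurable_fun_prod _ fun i _ => hg.comp (measurable_pi_apply i)
    rw [hk.2 n hn (fun x => ∏ i, g (x i)) hm
      fun σ x => Equiv.prod_comp σ fun i => g (x i)]
    calc _ ≤ ∫⁻ x : Fin n → EucSp d, (∏ i, g (x i)) * ENNReal.ofReal (ξ ^ n) :=
          lintegral_mono fun x => by gcongr; exact hR n hn x
      _ = _ := by
        rw [lintegral_mul_const _ hm, lintegral_pi_prod hg, ENNReal.ofReal_pow hξ, mul_pow, mul_comm]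

lemma lintegral_tsum_le [IsProbabilityMeasure μ] (hk : HasCorrFns μ k) (hξ : 0 ≤ ξ)
    (hR : RuelleBound k ξ) {g : EucSp d → ℝ≥0∞} (hg : Measurable g) :
    ∫⁻ γ, ∑' x : γ.1, g x.1 ∂μ ≤ ENNReal.ofReal ξ * ∫⁻ x, g x := by
  refine le_trans (lintegral_mono fun γ => ?_)
    ((lintegral_tsum_injTuples_le hk hξ hR hg 1).trans_eq (pow_one _))
  have hi : Function.Injective fun x : γ.1 =>
      (⟨fun _ => x.1, fun _ _ _ => Subsingleton.elim _ _, fun _ => x.2⟩ : injTuples 1 γ.1) :=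
    fun x y h => Subtype.ext (congrFun (Subtype.ext_iff.1 h) 0)
  simpa using ENNReal.tsum_comp_le_tsum_of_injective hi fun p => ∏ i, g (p.1 i)

/-- Expansion of a finite product over points of `γ` into sums over injective tuples. -/
lemma prod_one_add_le_tsum_injTuples (γ : Set (EucSp d)) (g : EucSp d → ℝ≥0∞) (F : Finset γ) :
    ∏ x ∈ F, (1 + g x.1) ≤
      ∑' n : ℕ, (n.factorial : ℝ≥0∞)⁻¹ * ∑' p : injTuples n γ, ∏ i, g (p.1 i) := by
  have h1 : ∀ t : Finset γ, ∏ x ∈ t, g x.1 =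
      ∑' e : Fin t.card ≃ t, (t.card.factorial : ℝ≥0∞)⁻¹ * ∏ i, g (e i).1.1 := by
    intro t
    have h : ∀ e : Fin t.card ≃ t, ∏ i, g (e i).1.1 = ∏ x ∈ t, g x.1 := fun e => by
      rw [Equiv.prod_comp e fun x => g x.1.1, Finset.prod_coe_sort t fun x => g x.1]
    simp_rw [h]
    rw [tsum_fintype, Finset.sum_const, Finset.card_univ,
      Fintype.card_equiv t.equivFin.symm, Fintype.card_fin, nsmul_eq_mul, ← mul_assoc,
      ENNReal.mul_inv_cancel (by exact_mod_cast t.card.factorial_ne_zero)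
        (ENNReal.natCast_ne_top _), one_mul]
  let ι : (Σ t : Finset γ, Fin t.card ≃ t) → Σ n : ℕ, injTuples n γ := fun a =>
    ⟨a.1.card, fun i => (a.2 i).1.1,
      (Subtype.val_injective.comp Subtype.val_injective).comp a.2.injective, fun i => (a.2 i).1.2⟩
  have hι : Function.Injective ι := by
    rintro ⟨t, e⟩ ⟨t', e'⟩ h
    have hr : ∀ (t : Finset γ) (e : Fin t.card ≃ t),
        Set.range (ι ⟨t, e⟩).2.1 = Subtype.val '' (t : Set γ) := by
      intro t e
      ext x
      constructor
      · rintro ⟨i, rfl⟩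
        exact ⟨(e i).1, (e i).2, rfl⟩
      · rintro ⟨y, hy, rfl⟩
        exact ⟨e.symm ⟨y, hy⟩, by simp [ι]⟩
    have ht : t = t' := by
      have := hr t e
      rw [h, hr t' e'] at this
      exact (Finset.coe_injective (Subtype.val_injective.image_injective this)).symm
    subst ht
    have h2 := congrArg Subtype.val (eq_of_heq (Sigma.mk.inj h).2)
    congr 1
    ext i : 2
    exact Subtype.ext (congrFun h2 i)
  calc ∏ x ∈ F, (1 + g x.1) = ∑ t ∈ F.powerset, ∏ x ∈ t, g x.1 := Finset.prod_one_add _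
    _ ≤ ∑' t : Finset γ, ∏ x ∈ t, g x.1 := ENNReal.sum_le_tsum _
    _ = ∑' a : (Σ t : Finset γ, Fin t.card ≃ t),
        (a.1.card.factorial : ℝ≥0∞)⁻¹ * ∏ i, g (a.2 i).1.1 := by
      rw [ENNReal.tsum_sigma']
      exact tsum_congr h1
    _ ≤ ∑' b : (Σ n : ℕ, injTuples n γ), (b.1.factorial : ℝ≥0∞)⁻¹ * ∏ i, g (b.2.1 i) :=
      ENNReal.tsum_comp_le_tsum_of_injective hι
        fun b => (b.1.factorial : ℝ≥0∞)⁻¹ * ∏ i, g (b.2.1 i)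
    _ = _ := by
      rw [ENNReal.tsum_sigma']
      simp only [ENNReal.tsum_mul_left]

lemma lintegral_tsum_factorial_ne_top [IsProbabilityMeasure μ] (hk : HasCorrFns μ k) (hξ : 0 ≤ ξ)
    (hR : RuelleBound k ξ) {g : EucSp d → ℝ≥0∞} (hg : Measurable g) (hgi : ∫⁻ x, g x ≠ ⊤) :
    ∫⁻ γ : Config d, ∑' n : ℕ, (n.factorial : ℝ≥0∞)⁻¹ *
      ∑' p : injTuples n γ.1, ∏ i, g (p.1 i) ∂μ ≠ ⊤ := by
  have hm : ∀ n, Measurable fun γ : Config d => ∑' p : injTuples n γ.1, ∏ i, g (p.1 i) :=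
    fun n => Config.measurable_tsum_injTuples n (f := fun x => ∏ i, g (x i))
      (Finset.measurable_fun_prod _ fun i _ => hg.comp (measurable_pi_apply i))
  rw [lintegral_tsum fun n => ((hm n).const_mul _).aemeasurable]
  set a := ENNReal.ofReal ξ * ∫⁻ x, g x with ha
  have ha_top : a ≠ ⊤ := ENNReal.mul_ne_top ENNReal.ofReal_ne_top hgi
  refine ne_top_of_le_ne_top
    (Real.summable_pow_div_factorial a.toReal).tsum_ofReal_ne_top (ENNReal.tsum_le_tsum fun n => ?_)
  rw [lintegral_const_mul _ (hm n), ENNReal.ofReal_div_of_pos (by positivity),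
    ENNReal.ofReal_pow ENNReal.toReal_nonneg, ENNReal.ofReal_toReal ha_top,
    ENNReal.ofReal_natCast, ENNReal.div_eq_inv_mul]
  gcongr
  exact lintegral_tsum_injTuples_le hk hξ hR hg n

end Correlations

section Exponentials

lemma rexp_coe (r : ℝ) : rexp (r : EReal) = Real.exp r := by
  simp [rexp, eexp, Real.exp_nonneg]

lemma measurable_rexp : Measurable rexp := by
  refine Measurable.ennreal_toReal (Measurable.ite (measurableSet_singleton ⊤) measurable_const
    (Measurable.ite (measurableSet_singleton ⊥) measurable_const ?_))
  exact (Real.measurable_exp.comp measurable_ereal_toReal).ennreal_ofReal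

lemma abs_le_exp_mul_abs_exp_neg_sub_one {r C : ℝ} (h : |r| ≤ C) :
    |r| ≤ Real.exp C * |Real.exp (-r) - 1| := by
  have hC : 1 ≤ Real.exp C := Real.one_le_exp ((abs_nonneg r).trans h)
  rcases le_total r 0 with hr | hr
  · have h1 := Real.add_one_le_exp (-r)
    rw [abs_of_nonpos hr, abs_of_nonneg (by linarith)]
    nlinarith
  · have h1 := Real.add_one_le_exp r
    have h2 : Real.exp (-r) ≤ 1 := Real.exp_le_one_iff.2 (by linarith)
    have h3 : Real.exp r * Real.exp (-r) = 1 := by rw [← Real.exp_add]; simp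
    have h4 : Real.exp r ≤ Real.exp C := Real.exp_le_exp.2 ((le_abs_self r).trans h)
    rw [abs_of_nonneg hr, abs_of_nonpos (by linarith)]
    nlinarith

lemma exp_mul_le_one_add_abs {t r : ℝ} (ht0 : -1 ≤ t) (ht1 : t ≤ 0) :
    Real.exp (t * r) ≤ 1 + |Real.exp (-r) - 1| := by
  rcases le_total r 0 with hr | hr
  · have h1 : Real.exp (t * r) ≤ Real.exp (-r) := Real.exp_le_exp.2 (by nlinarith)
    have h2 := le_abs_self (Real.exp (-r) - 1)
    linarith
  · have h1 : Real.exp (t * r) ≤ 1 :=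
      Real.exp_le_one_iff.2 (mul_nonpos_of_nonpos_of_nonneg ht1 hr)
    have h2 := abs_nonneg (Real.exp (-r) - 1)
    linarith

end Exponentials

section Potential

variable {d : ℕ} {μ : Measure (Config d)} {k : ∀ n : ℕ, (Fin n → EucSp d) → ℝ} {ξ : ℝ}
  {φ : EucSp d → EReal}

/-- The Mayer function `|e^{-φ} - 1|`, with values in `[0,∞]`. -/
def mayer (φ : EucSp d → EReal) (x : EucSp d) : ℝ≥0∞ := ENNReal.ofReal |rexp (-(φ x)) - 1|

lemma measurable_mayer (hφ : Measurable φ) : Measurable (mayer φ) :=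
  (((measurable_rexp.comp hφ.neg).sub_const 1).abs).ennreal_ofReal

lemma LAHT.lintegral_mayer_ne_top {z B : ℝ} (h : LAHT φ z B) (hφ : Measurable φ) (hz : 0 < z) :
    ∫⁻ x, mayer φ x ≠ ⊤ := by
  have h1 := h.ne_top
  simp_rw [ENNReal.ofReal_mul (abs_nonneg _)] at h1
  change ∫⁻ x, mayer φ x * _ ≠ ⊤ at h1
  rw [lintegral_mul_const _ (measurable_mayer hφ)] at h1
  intro h2
  rw [h2, ENNReal.top_mul (by simpa using hz)] at h1
  exact h1 rfl

lemma ae_notMem [IsProbabilityMeasure μ] (hd : 0 < d) (hk : HasCorrFns μ k) (hξ : 0 ≤ ξ)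
    (hR : RuelleBound k ξ) (a : EucSp d) : ∀ᵐ γ ∂μ, a ∉ γ.1 := by
  have : Nonempty (Fin d) := ⟨⟨0, hd⟩⟩
  have hg : Measurable (({a} : Set (EucSp d)).indicator (1 : EucSp d → ℝ≥0∞)) :=
    measurable_one.indicator (measurableSet_singleton a)
  have hint := lintegral_tsum_le hk hξ hR hg
  rw [lintegral_indicator_one (measurableSet_singleton a), measure_singleton, mul_zero,
    nonpos_iff_eq_zero, lintegral_eq_zero_iff (Config.measurable_tsum_coe hg)] at hint
  filter_upwards [hint] with γ hγ ha
  have := ENNReal.tsum_eq_zero.1 hγ ⟨a, ha⟩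
  simp at this

lemma ae_summable [IsProbabilityMeasure μ] (hk : HasCorrFns μ k) (hξ : 0 ≤ ξ)
    (hR : RuelleBound k ξ) (hφ : Measurable φ)
    (hb : ∃ R C : ℝ, ∀ x : EucSp d, R ≤ ‖x‖ → ∃ r : ℝ, φ x = (r : EReal) ∧ |r| ≤ C)
    (hM : ∫⁻ x, mayer φ x ≠ ⊤) :
    ∀ᵐ γ ∂μ, Summable fun y : γ.1 => (φ y.1).toReal := by
  obtain ⟨R, C, hRC⟩ := hb
  set out : Set (EucSp d) := {x | R ≤ ‖x‖}
  have hout : MeasurableSet out := measurableSet_le measurable_const measurable_norm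
  have hψ : Measurable fun x => (φ x).toReal := measurable_ereal_toReal.comp hφ
  have hg : Measurable (out.indicator fun x => ENNReal.ofReal |(φ x).toReal|) :=
    hψ.abs.ennreal_ofReal.indicator hout
  have hle : ∀ x, out.indicator (fun x => ENNReal.ofReal |(φ x).toReal|) x ≤
      ENNReal.ofReal (Real.exp C) * mayer φ x := by
    intro x
    refine Set.indicator_apply_le' (fun hx => ?_) fun _ => zero_le
    obtain ⟨r, hr, hrC⟩ := hRC x hx
    rw [mayer, ← ENNReal.ofReal_mul (Real.exp_nonneg _), hr, ← EReal.coe_neg, rexp_coe,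
      EReal.toReal_coe]
    exact ENNReal.ofReal_le_ofReal (abs_le_exp_mul_abs_exp_neg_sub_one hrC)
  have hfin : ∫⁻ x, out.indicator (fun x => ENNReal.ofReal |(φ x).toReal|) x ≠ ⊤ := by
    refine ne_top_of_le_ne_top ?_ (lintegral_mono hle)
    rw [lintegral_const_mul _ (measurable_mayer hφ)]
    exact ENNReal.mul_ne_top ENNReal.ofReal_ne_top hM
  have hae := ae_lt_top (Config.measurable_tsum_coe hg)
    (ne_top_of_le_ne_top (ENNReal.mul_ne_top ENNReal.ofReal_ne_top hfin)
      (lintegral_tsum_le hk hξ hR hg))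
  filter_upwards [hae] with γ hγ
  have h1 : Summable fun y : γ.1 => out.indicator (fun x => (φ x).toReal) y.1 := by
    refine Summable.of_norm ?_
    refine (ENNReal.summable_toReal hγ.ne).congr fun y => ?_
    by_cases hy : y.1 ∈ out <;> simp [hy]
  have h2 : Summable fun y : γ.1 => outᶜ.indicator (fun x => (φ x).toReal) y.1 := by
    refine summable_of_hasFiniteSupport ?_
    refine Set.Finite.subset ((γ.2 _ (isCompact_closedBall 0 R)).preimage
      Subtype.val_injective.injOn) fun y hy => ⟨y.2, ?_⟩
    have hy' : y.1 ∉ out := Set.mem_of_indicator_ne_zero hy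
    simpa using (not_le.1 hy').le
  refine (h1.add h2).congr fun y => ?_
  exact (congrFun (Set.indicator_self_add_compl out fun x => (φ x).toReal) y.1)

lemma totPhi_of_summable {γ : Set (EucSp d)} (h1 : ∀ y ∈ γ, φ y ≠ ⊤)
    (h2 : Summable fun y : γ => (φ y.1).toReal) :
    totPhi φ γ = ((∑' y : γ, (φ y.1).toReal : ℝ) : EReal) := if_pos ⟨h1, h2⟩

lemma ofReal_exp_mul_tsum_le {γ : Set (EucSp d)} {t : ℝ} (ht0 : -1 ≤ t) (ht1 : t ≤ 0)
    (hbot : ∀ x, φ x ≠ ⊥) (h1 : ∀ y ∈ γ, φ y ≠ ⊤)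
    (h2 : Summable fun y : γ => (φ y.1).toReal) :
    ENNReal.ofReal (Real.exp (t * ∑' y : γ, (φ y.1).toReal)) ≤
      ∑' n : ℕ, (n.factorial : ℝ≥0∞)⁻¹ * ∑' p : injTuples n γ, ∏ i, mayer φ (p.1 i) := by
  have hc : Continuous fun r : ℝ => ENNReal.ofReal (Real.exp (t * r)) :=
    ENNReal.continuous_ofReal.comp (by fun_prop)
  refine le_of_tendsto' ((hc.tendsto _).comp h2.hasSum) fun F => ?_
  refine le_trans ?_ (prod_one_add_le_tsum_injTuples γ (mayer φ) F)
  rw [Function.comp_apply, Finset.mul_sum, Real.exp_sum,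
    ENNReal.ofReal_prod_of_nonneg fun _ _ => Real.exp_nonneg _]
  refine Finset.prod_le_prod' fun x _ => ?_
  rw [mayer, ← ENNReal.ofReal_one, ← ENNReal.ofReal_add zero_le_one (abs_nonneg _)]
  refine ENNReal.ofReal_le_ofReal ?_
  conv_rhs => rw [← EReal.coe_toReal (h1 x x.2) (hbot x), ← EReal.coe_neg, rexp_coe]
  exact exp_mul_le_one_add_abs ht0 ht1

lemma aemeasurable_tsum_toReal (hφ : Measurable φ)
    (h : ∀ᵐ γ ∂μ, Summable fun y : γ.1 => (φ y.1).toReal) :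
    AEMeasurable (fun γ : Config d => ∑' y : γ.1, (φ y.1).toReal) μ := by
  have hψ : Measurable fun x => (φ x).toReal := measurable_ereal_toReal.comp hφ
  have hp := Config.measurable_tsum_coe hψ.ennreal_ofReal
  have hn := Config.measurable_tsum_coe hψ.neg.ennreal_ofReal
  refine ⟨_, hp.ennreal_toReal.sub hn.ennreal_toReal, ?_⟩
  filter_upwards [h] with γ hγ
  have hpos : ∀ f : γ.1 → ℝ, Summable f →
      (∑' y, ENNReal.ofReal (f y)).toReal = ∑' y, max (f y) 0 := fun f _ => by
    rw [ENNReal.tsum_toReal_eq fun _ => ENNReal.ofReal_ne_top]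
    exact tsum_congr fun y => ENNReal.toReal_ofReal'
  have hmax : ∀ f : γ.1 → ℝ, Summable f → Summable fun y => max (f y) 0 := fun f hf =>
    hf.abs.of_nonneg_of_le (fun _ => le_max_right _ _)
      fun y => max_le (le_abs_self _) (abs_nonneg _)
  change _ = (∑' y : γ.1, ENNReal.ofReal (φ y.1).toReal).toReal -
    (∑' y : γ.1, ENNReal.ofReal (-(φ y.1).toReal)).toReal
  rw [hpos _ hγ, hpos _ hγ.neg, ← (hmax _ hγ).tsum_sub (hmax _ hγ.neg)]
  refine tsum_congr fun y => ?_
  rcases le_total (φ y.1).toReal 0 with h | h <;> simp [h]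

end Potential

/-- the normalizing integral `∫_Γ exp[(s-1) ∑_{u∈γ} φ(u)] dμ(γ)` is well
defined (the integrand being interpreted as `0` when the sum is `+∞`), finite, and
strictly positive, so its reciprocal makes sense. -/
theorem statement19 (d : ℕ) (s z B ξ : ℝ) (φ : EucSp d → EReal) (μ : Measure (Config d))
    (k u : ∀ n : ℕ, (Fin n → EucSp d) → ℝ) (hset : Setting d s z B ξ φ μ k u) :
    Integrable (fun γ : Config d => rexp (((s - 1 : ℝ) : EReal) * totPhi φ γ.1)) μ ∧
    0 < ∫ γ, rexp (((s - 1 : ℝ) : EReal) * totPhi φ γ.1) ∂μ := by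
  have := hset.prob
  have hbad : ∀ᵐ γ ∂μ, ∀ y ∈ γ.1, φ y ≠ ⊤ := by
    filter_upwards [ae_notMem hset.hd hset.corr hset.hξ.le hset.ruelle 0] with γ hγ y hy
    exact hset.pp.finite_off y fun h => hγ (h ▸ hy)
  have hM := hset.laht.lintegral_mayer_ne_top hset.pp.meas hset.hz
  have hsum := ae_summable hset.corr hset.hξ.le hset.ruelle hset.pp.meas hset.bddOutside hM
  have heq : (fun γ : Config d => rexp (((s - 1 : ℝ) : EReal) * totPhi φ γ.1)) =ᵐ[μ]
      fun γ => Real.exp ((s - 1) * ∑' y : γ.1, (φ y.1).toReal) := by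
    filter_upwards [hbad, hsum] with γ h1 h2
    rw [totPhi_of_summable h1 h2, ← EReal.coe_mul, rexp_coe]
  have hint : Integrable
      (fun γ : Config d => Real.exp ((s - 1) * ∑' y : γ.1, (φ y.1).toReal)) μ := by
    refine ⟨(Real.measurable_exp.comp_aemeasurable
      ((aemeasurable_tsum_toReal hset.pp.meas hsum).const_mul _)).aestronglyMeasurable, ?_⟩
    rw [hasFiniteIntegral_iff_ofReal (ae_of_all _ fun _ => Real.exp_nonneg _)]
    refine lt_of_le_of_lt (lintegral_mono_ae ?_)
      (lintegral_tsum_factorial_ne_top hset.corr hset.hξ.le hset.ruelle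
        (measurable_mayer hset.pp.meas) hM).lt_top
    filter_upwards [hbad, hsum] with γ h1 h2
    exact ofReal_exp_mul_tsum_le (by linarith [hset.hs0]) (by linarith [hset.hs1])
      hset.pp.ne_bot h1 h2
  refine ⟨hint.congr heq.symm, ?_⟩
  rw [integral_congr_ae heq]
  exact integral_exp_pos hint

end
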